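/- arXiv:1608.07652 — 2 statements merged into one kernel-verified Lean document; each statement's English description precedes it below -/
import Mathlib

section
/- Let d ≥ 1 and let S, T ⊆ {1,…,d} be disjoint. Then the truncated function h' is nondecreasing in every coordinate: for every i ∈ {1,…,d} and every x ∈ {0,1}^d, h'(x[i:=0]) ≤ h'(x[i:=1]). In particular, h' is unate. -/
open Finset
open scoped Classical

/-- Hamming weight of a point of the hypercube `{0,1}^d`. -/
def hammingWt {d : ℕ} (x : Fin d → Bool) : ℕ :=
  (univ.filter fun i => x i).card

/-- The character `χ_S(x) = (-1)^{Σ_{i∈S} x_i}`. -/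
def chi {d : ℕ} (S : Finset (Fin d)) (x : Fin d → Bool) : ℤ :=
  (-1) ^ (S.filter fun i => x i).card

/-- The function `h(x) = 2|x| + χ_S(x) + χ_T(x)`. -/
def hFun {d : ℕ} (S T : Finset (Fin d)) (x : Fin d → Bool) : ℤ :=
  2 * (hammingWt x : ℤ) + chi S x + chi T x

/-- The truncated function `h'`. -/
noncomputable def hFun' {d : ℕ} (S T : Finset (Fin d)) (x : Fin d → Bool) : ℝ :=
  if (hammingWt x : ℝ) < d / 2 - 3 * Real.sqrt d then d - 6 * Real.sqrt d - 2
  else if (hammingWt x : ℝ) > d / 2 + 3 * Real.sqrt d then d + 6 * Real.sqrt d + 2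
  else (hFun S T x : ℝ)

/-- A function on the hypercube is unate if there is an orientation of the
coordinates making it monotone with respect to that orientation. -/
def IsUnate {d : ℕ} {R : Type*} [Preorder R] (f : (Fin d → Bool) → R) : Prop :=
  ∃ σ : Fin d → Bool, ∀ (i : Fin d) (x : Fin d → Bool),
    if σ i then f (Function.update x i false) ≤ f (Function.update x i true)
    else f (Function.update x i true) ≤ f (Function.update x i false)

theorem hammingWt_update_true {d : ℕ} (i : Fin d) (x : Fin d → Bool) :
    hammingWt (Function.update x i true) = hammingWt (Function.update x i false) + 1 := by
  unfold hammingWt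
  have h : (univ.filter fun j => Function.update x i true j = true) =
      insert i (univ.filter fun j => Function.update x i false j = true) := by
    ext j
    by_cases hj : j = i
    · subst hj; simp
    · simp [hj]
  rw [h, card_insert_of_notMem (by simp)]

theorem chi_update_of_notMem {d : ℕ} {S : Finset (Fin d)} {i : Fin d} (hi : i ∉ S)
    (x : Fin d → Bool) (b : Bool) : chi S (Function.update x i b) = chi S x := by
  unfold chi
  congr 2
  refine filter_congr fun j hj => ?_
  have hji : j ≠ i := fun h => hi (h ▸ hj)
  simp [hji]

theorem chi_mem_Icc {d : ℕ} (S : Finset (Fin d)) (x : Fin d → Bool) :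
    -1 ≤ chi S x ∧ chi S x ≤ 1 := by
  unfold chi
  rcases neg_one_pow_eq_or ℤ (S.filter fun i => x i).card with h | h <;> rw [h] <;> norm_num

theorem hFun_update_le {d : ℕ} {S T : Finset (Fin d)} (hST : Disjoint S T) (i : Fin d)
    (x : Fin d → Bool) :
    hFun S T (Function.update x i false) ≤ hFun S T (Function.update x i true) := by
  have hw := hammingWt_update_true i x
  have hS₀ := chi_mem_Icc S (Function.update x i false)
  have hS₁ := chi_mem_Icc S (Function.update x i true)
  have hT₀ := chi_mem_Icc T (Function.update x i false)
  have hT₁ := chi_mem_Icc T (Function.update x i true)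
  unfold hFun
  by_cases hi : i ∈ S
  · have hiT : i ∉ T := disjoint_left.mp hST hi
    rw [chi_update_of_notMem hiT, chi_update_of_notMem hiT]
    omega
  · rw [chi_update_of_notMem hi, chi_update_of_notMem hi]
    omega

theorem hFun_bounds {d : ℕ} (S T : Finset (Fin d)) (x : Fin d → Bool) :
    2 * (hammingWt x : ℝ) - 2 ≤ hFun S T x ∧ (hFun S T x : ℝ) ≤ 2 * hammingWt x + 2 := by
  have hS := chi_mem_Icc S x
  have hT := chi_mem_Icc T x
  have hl : 2 * (hammingWt x : ℤ) - 2 ≤ hFun S T x := by unfold hFun; omega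
  have hu : hFun S T x ≤ 2 * (hammingWt x : ℤ) + 2 := by unfold hFun; omega
  exact ⟨by exact_mod_cast hl, by exact_mod_cast hu⟩

theorem hFun'_update_le {d : ℕ} {S T : Finset (Fin d)} (hST : Disjoint S T) (i : Fin d)
    (x : Fin d → Bool) :
    hFun' S T (Function.update x i false) ≤ hFun' S T (Function.update x i true) := by
  have hw : (hammingWt (Function.update x i true) : ℝ) =
      hammingWt (Function.update x i false) + 1 := by
    exact_mod_cast hammingWt_update_true i x
  have hh : (hFun S T (Function.update x i false) : ℝ) ≤ hFun S T (Function.update x i true) := by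
    exact_mod_cast hFun_update_le hST i x
  have h₀ := hFun_bounds S T (Function.update x i false)
  have h₁ := hFun_bounds S T (Function.update x i true)
  have hs := Real.sqrt_nonneg (d : ℝ)
  unfold hFun'
  split_ifs <;> linarith

theorem stmt_5 (d : ℕ) (hd : 1 ≤ d) (S T : Finset (Fin d)) (hST : Disjoint S T) :
    (∀ (i : Fin d) (x : Fin d → Bool),
      hFun' S T (Function.update x i false) ≤ hFun' S T (Function.update x i true)) ∧
    IsUnate (hFun' S T) := by
  exact ⟨hFun'_update_le hST, fun _ => true, fun i x => by simpa using hFun'_update_le hST i x⟩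
end

section
/- Fix integers n ≥ 1 and d ≥ 1, a function f : [n]^d → ℝ, a set T ⊆ {1,…,d}, and ε ∈ (0,1). For w : ({1,…,d}\T) → [n], define g_w : [n]^d → ℝ by g_w(x) = f(x|_T ∘_T w), and let dist(g_w, f) = |{x ∈ [n]^d : g_w(x) ≠ f(x)}| / n^d. If Φ_f(T) < ε/16, then the number of assignments w : ({1,…,d}\T) → [n] with dist(g_w, f) > ε/2 is at most n^{d−|T|} / 6. -/
open Finset
open scoped Classical

/-- The point of `[n]^d` agreeing with `z` on the coordinates in `T` and with
`w` on the coordinates outside `T`. -/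
def combine {n d : ℕ} (T : Finset (Fin d))
    (z : {i : Fin d // i ∈ T} → Fin n) (w : {i : Fin d // i ∉ T} → Fin n) :
    Fin d → Fin n :=
  fun i => if h : i ∈ T then z ⟨i, h⟩ else w ⟨i, h⟩

/-- `P_v^z`: the fraction of assignments `w` to the coordinates outside `T`
for which `f(z ∘_T w) = v`. -/
noncomputable def Pfrac {n d : ℕ} (f : (Fin d → Fin n) → ℝ) (T : Finset (Fin d))
    (z : {i : Fin d // i ∈ T} → Fin n) (v : ℝ) : ℝ :=
  ((univ.filter fun w : {i : Fin d // i ∉ T} → Fin n =>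
      f (combine T z w) = v).card : ℝ) / (n : ℝ) ^ (d - T.card)

/-- `Φ_f(T) = n^{-|T|} Σ_z Σ_{v ∈ image f} P_v^z (1 - P_v^z)`. -/
noncomputable def Phi {n d : ℕ} (f : (Fin d → Fin n) → ℝ) (T : Finset (Fin d)) : ℝ :=
  (∑ z : {i : Fin d // i ∈ T} → Fin n, ∑ v ∈ univ.image f,
      Pfrac f T z v * (1 - Pfrac f T z v)) / (n : ℝ) ^ T.card

/-- Splitting a point of `[n]^d` into its restrictions to `T` and to the complement of `T`. -/
def combineEquiv {n d : ℕ} (T : Finset (Fin d)) :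
    ({i : Fin d // i ∈ T} → Fin n) × ({i : Fin d // i ∉ T} → Fin n) ≃ (Fin d → Fin n) where
  toFun p := combine T p.1 p.2
  invFun x := (fun i => x i.1, fun i => x i.1)
  left_inv p := by
    ext i
    · simp [combine, i.2]
    · simp [combine, i.2]
  right_inv x := by
    ext i
    simp [combine]

theorem card_assignments_mem (n : ℕ) {d : ℕ} (T : Finset (Fin d)) :
    Fintype.card ({i : Fin d // i ∈ T} → Fin n) = n ^ T.card := by
  simp

theorem card_assignments_notMem (n : ℕ) {d : ℕ} (T : Finset (Fin d)) :
    Fintype.card ({i : Fin d // i ∉ T} → Fin n) = n ^ (d - T.card) := by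
  simp [Fintype.card_subtype_compl]

/-- The number of ordered pairs on which `g` differs, counted through the fibres of `g`. -/
theorem sum_card_ne_eq_sum_fiber {α β : Type*} [Fintype α] (g : α → β) (S : Finset β)
    (hS : ∀ a, g a ∈ S) :
    ∑ a, ((univ.filter fun b => g a ≠ g b).card : ℝ) =
      ∑ v ∈ S, ((univ.filter fun a => g a = v).card : ℝ) *
        (Fintype.card α - (univ.filter fun a => g a = v).card) := by
  rw [← Finset.sum_fiberwise_of_maps_to (s := univ) (t := S) (g := g) fun a _ => hS a]
  refine Finset.sum_congr rfl fun v _ => ?_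
  rw [← nsmul_eq_mul, ← Finset.sum_const]
  refine Finset.sum_congr rfl fun a ha => ?_
  have hsplit := Finset.card_filter_add_card_filter_not (s := (univ : Finset α)) (fun b => g b = v)
  rw [Finset.card_univ] at hsplit
  rw [← hsplit, (Finset.mem_filter.mp ha).2]
  simp [eq_comm]

theorem card_filter_ne_eq_sum {n d : ℕ} (f : (Fin d → Fin n) → ℝ) (T : Finset (Fin d))
    (w : {i : Fin d // i ∉ T} → Fin n) :
    (univ.filter fun x : Fin d → Fin n => f (combine T (fun i => x i.1) w) ≠ f x).card =
      ∑ z : {i : Fin d // i ∈ T} → Fin n,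
        (univ.filter fun w' => f (combine T z w) ≠ f (combine T z w')).card := by
  simp only [Finset.card_filter]
  rw [← (combineEquiv T).sum_comp, Fintype.sum_prod_type]
  refine Finset.sum_congr rfl fun z _ => Finset.sum_congr rfl fun w' _ => ?_
  have hz : (fun i : {i : Fin d // i ∈ T} => combineEquiv T (z, w') i.1) = z :=
    congrArg Prod.fst ((combineEquiv T).symm_apply_apply (z, w'))
  rw [hz]
  rfl

/-- `Φ_f(T)` is the average over `w` of the distance between `g_w` and `f`. -/
theorem sum_card_filter_ne_eq_Phi {n d : ℕ} (hn : 1 ≤ n) (f : (Fin d → Fin n) → ℝ)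
    (T : Finset (Fin d)) :
    ∑ w : {i : Fin d // i ∉ T} → Fin n, ((univ.filter fun x : Fin d → Fin n =>
        f (combine T (fun i => x i.1) w) ≠ f x).card : ℝ) / (n : ℝ) ^ d =
      Phi f T * (n : ℝ) ^ (d - T.card) := by
  have hn0 : (n : ℝ) ≠ 0 := by positivity
  have hN : (n : ℝ) ^ (d - T.card) ≠ 0 := pow_ne_zero _ hn0
  have hM : (n : ℝ) ^ T.card ≠ 0 := pow_ne_zero _ hn0
  have hMN : (n : ℝ) ^ d = (n : ℝ) ^ T.card * (n : ℝ) ^ (d - T.card) := by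
    rw [← pow_add, Nat.add_sub_cancel' (by simpa using Finset.card_le_univ T)]
  have hfiber (z : {i : Fin d // i ∈ T} → Fin n) :
      ∑ w, ((univ.filter fun w' => f (combine T z w) ≠ f (combine T z w')).card : ℝ) =
        (∑ v ∈ univ.image f, Pfrac f T z v * (1 - Pfrac f T z v)) *
          ((n : ℝ) ^ (d - T.card)) ^ 2 := by
    rw [sum_card_ne_eq_sum_fiber (fun w => f (combine T z w)) (univ.image f)
      (fun w => Finset.mem_image_of_mem f (Finset.mem_univ _)), Finset.sum_mul]
    refine Finset.sum_congr rfl fun v _ => ?_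
    rw [card_assignments_notMem, Pfrac]
    push_cast
    field_simp
  simp only [card_filter_ne_eq_sum, Nat.cast_sum]
  rw [← Finset.sum_div, Finset.sum_comm, Finset.sum_congr rfl fun z _ => hfiber z,
    ← Finset.sum_mul, Phi, hMN]
  field_simp

theorem stmt_18 (n d : ℕ) (hn : 1 ≤ n) (hd : 1 ≤ d) (f : (Fin d → Fin n) → ℝ)
    (T : Finset (Fin d)) (ε : ℝ) (hε0 : 0 < ε) (hε1 : ε < 1)
    (hPhi : Phi f T < ε / 16) :
    ((univ.filter fun w : {i : Fin d // i ∉ T} → Fin n =>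
        ((univ.filter fun x : Fin d → Fin n =>
            f (combine T (fun i => x i.1) w) ≠ f x).card : ℝ) / (n : ℝ) ^ d >
          ε / 2).card : ℝ) ≤
      (n : ℝ) ^ (d - T.card) / 6 := by
  have hN : (0 : ℝ) < (n : ℝ) ^ (d - T.card) := by positivity
  have hmarkov := Finset.card_nsmul_le_sum (univ.filter fun w : {i : Fin d // i ∉ T} → Fin n =>
        ((univ.filter fun x : Fin d → Fin n =>
            f (combine T (fun i => x i.1) w) ≠ f x).card : ℝ) / (n : ℝ) ^ d > ε / 2)
      _ (ε / 2) fun w hw => (Finset.mem_filter.mp hw).2.le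
  have hsub := hmarkov.trans <| (Finset.sum_le_univ_sum_of_nonneg fun w => by positivity).trans_eq
    (sum_card_filter_ne_eq_Phi hn f T)
  rw [nsmul_eq_mul] at hsub
  have hlt := hsub.trans_lt (mul_lt_mul_of_pos_right hPhi hN)
  refine le_of_mul_le_mul_right (hlt.le.trans ?_) (half_pos hε0)
  nlinarith [mul_pos hε0 hN]
end
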